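/- arXiv:1611.09018 — 3 statements merged into one kernel-verified Lean document; each statement's English description precedes it below -/
import Mathlib

section
/- For every n ≥ 1, LS_n = LA_n + Σ_{k=1}^{n} C(3n, 3k−1) · LB_{k−1} · LS_{n−k}, where C(m,r) denotes the binomial coefficient. -/
/-- `LAcount n`: linear extensions of the poset `A_n` — permutations `σ` of `{1,…,3n}`
(modeled 0-based on `Fin (3n)`) with `σ(3i+1) < σ(3i+2)`, `σ(3i+1) < σ(3i+3)` for
`0 ≤ i ≤ n-1` and `σ(3i) < σ(3i+2)` for `1 ≤ i ≤ n-1` (1-based positions). -/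
def LAset (n : ℕ) : Finset (Equiv.Perm (Fin (3*n))) :=
  Finset.univ.filter fun σ =>
    (∀ i < n, ∃ h : 3*i+2 < 3*n,
        σ ⟨3*i, by omega⟩ < σ ⟨3*i+1, by omega⟩ ∧ σ ⟨3*i, by omega⟩ < σ ⟨3*i+2, h⟩) ∧
    (∀ i < n, 1 ≤ i → ∃ h : 3*i+1 < 3*n, σ ⟨3*i-1, by omega⟩ < σ ⟨3*i+1, h⟩)

def LAcount (n : ℕ) : ℕ := (LAset n).card

/-- `LEcount n`: linear extensions of `E_n` — permutations of `{1,…,3n+1}` with the `A_n`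
constraints together with `σ(3n) < σ(3n+1)` (1-based positions). -/
def LEset (n : ℕ) : Finset (Equiv.Perm (Fin (3*n+1))) :=
  Finset.univ.filter fun σ =>
    (∀ i < n, ∃ h : 3*i+2 < 3*n+1,
        σ ⟨3*i, by omega⟩ < σ ⟨3*i+1, by omega⟩ ∧ σ ⟨3*i, by omega⟩ < σ ⟨3*i+2, h⟩) ∧
    (∀ i < n, 1 ≤ i → ∃ h : 3*i+1 < 3*n+1, σ ⟨3*i-1, by omega⟩ < σ ⟨3*i+1, h⟩) ∧
    (∀ _h : 1 ≤ n, σ ⟨3*n-1, by omega⟩ < σ ⟨3*n, by omega⟩)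

def LEcount (n : ℕ) : ℕ := (LEset n).card

/-- `LScount n`: linear extensions of `S_n` — permutations of `{1,…,3n+1}` with
`σ(3i+2) < σ(3i+3)`, `σ(3i+2) < σ(3i+4)` for `0 ≤ i ≤ n-1`, `σ(3i+1) < σ(3i+3)` for
`1 ≤ i ≤ n-1`, and `σ(1) < σ(3)` (1-based positions). -/
def LSset (n : ℕ) : Finset (Equiv.Perm (Fin (3*n+1))) :=
  Finset.univ.filter fun σ =>
    (∀ i < n, ∃ h : 3*i+3 < 3*n+1,
        σ ⟨3*i+1, by omega⟩ < σ ⟨3*i+2, by omega⟩ ∧ σ ⟨3*i+1, by omega⟩ < σ ⟨3*i+3, h⟩) ∧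
    (∀ i < n, 1 ≤ i → ∃ h : 3*i+2 < 3*n+1, σ ⟨3*i, by omega⟩ < σ ⟨3*i+2, h⟩) ∧
    (∀ _h : 1 ≤ n, σ ⟨0, by omega⟩ < σ ⟨2, by omega⟩)

def LScount (n : ℕ) : ℕ := (LSset n).card

/-- `LBcount n`: linear extensions of `B_n` — permutations of `{1,…,3n+2}` with the `S_n`
constraints together with `σ(3n+1) < σ(3n+2)` (1-based positions). -/
def LBset (n : ℕ) : Finset (Equiv.Perm (Fin (3*n+2))) :=
  Finset.univ.filter fun σ =>
    (∀ i < n, ∃ h : 3*i+3 < 3*n+2,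
        σ ⟨3*i+1, by omega⟩ < σ ⟨3*i+2, by omega⟩ ∧ σ ⟨3*i+1, by omega⟩ < σ ⟨3*i+3, h⟩) ∧
    (∀ i < n, 1 ≤ i → ∃ h : 3*i+2 < 3*n+2, σ ⟨3*i, by omega⟩ < σ ⟨3*i+2, h⟩) ∧
    (∀ _h : 1 ≤ n, σ ⟨0, by omega⟩ < σ ⟨2, by omega⟩) ∧
    σ ⟨3*n, by omega⟩ < σ ⟨3*n+1, by omega⟩

def LBcount (n : ℕ) : ℕ := (LBset n).card

/-- The number of bijections `α ≃ Fin m` that are increasing along the relation `r`. -/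
noncomputable def linExtCount {α : Type*} (r : α → α → Prop) (m : ℕ) : ℕ :=
  Nat.card {e : α ≃ Fin m // ∀ a b, r a b → e a < e b}

theorem linExtCount_congr {α β : Type*} {r : α → α → Prop} {s : β → β → Prop} (f : α ≃ β)
    (h : ∀ a b, r a b ↔ s (f a) (f b)) (m : ℕ) : linExtCount r m = linExtCount s m := by
  refine Nat.card_congr ((Equiv.equivCongr f (Equiv.refl _)).subtypeEquiv fun e => ?_)
  simp [h, f.forall_congr_left]

/-- Linear extensions in which a minimal element `none` comes first. -/
theorem card_linExt_none_eq_zero {β : Type*} (r : Option β → Option β → Prop)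
    (hr : ∀ x, ¬ r x none) (m : ℕ) :
    Nat.card {e : Option β ≃ Fin (m + 1) // (∀ a b, r a b → e a < e b) ∧ e none = 0} =
      linExtCount (fun a b => r (some a) (some b)) m := by
  symm
  refine Nat.card_eq_of_bijective
    (fun e => ⟨e.1.optionCongr.trans (finSuccEquiv m).symm, ?_, by simp⟩) ⟨?_, ?_⟩
  · rintro (_ | a) (_ | b) hab
    · exact absurd hab (hr _)
    · simp
    · exact absurd hab (hr _)
    · simpa using e.2 a b hab
  · rintro ⟨e, he⟩ ⟨e', he'⟩ h
    ext x
    have := congrArg (fun g => (g.1 (some x)).val) h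
    simpa using this
  · rintro ⟨e, he, h0⟩
    have key : (Equiv.removeNone (e.trans (finSuccEquiv m))).optionCongr =
        e.trans (finSuccEquiv m) := by
      have hn : (e.trans (finSuccEquiv m)) none = none := by simp [h0]
      refine Equiv.ext fun x => ?_
      rcases x with _ | x
      · simp [h0]
      · refine Equiv.removeNone_some _ (Option.ne_none_iff_exists'.1 fun h => ?_)
        simpa using (e.trans (finSuccEquiv m)).injective (h.trans hn.symm)
    have key' : (Equiv.removeNone (e.trans (finSuccEquiv m))).optionCongr.trans
        (finSuccEquiv m).symm = e := by
      rw [key]; ext; simp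
    refine ⟨⟨Equiv.removeNone (e.trans (finSuccEquiv m)), fun a b hab => ?_⟩,
      Subtype.ext key'⟩
    have := he _ _ hab
    rw [← key'] at this
    simpa using this

/-- Linear extensions of a disjoint union are shuffles of linear extensions of the two parts. -/
theorem linExtCount_sum {α β : Type*} (r : α ⊕ β → α ⊕ β → Prop)
    (h₁ : ∀ a b, ¬ r (.inl a) (.inr b)) (h₂ : ∀ a b, ¬ r (.inr b) (.inl a))
    {m k : ℕ} (eα : α ≃ Fin m) (eβ : β ≃ Fin k) :
    linExtCount r (m + k) = (m + k).choose m *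
      linExtCount (fun a b => r (.inl a) (.inl b)) m *
      linExtCount (fun a b => r (.inr a) (.inr b)) k := by
  have hs : Nat.card {s : Finset (Fin (m + k)) // s.card = m} = (m + k).choose m := by
    simp [Nat.card_eq_fintype_card]
  rw [← hs, linExtCount, linExtCount, linExtCount, ← Nat.card_prod, ← Nat.card_prod]
  symm
  have hc : ∀ s : Finset (Fin (m + k)), s.card = m → sᶜ.card = k := fun s hs => by
    simp [Finset.card_compl, hs]
  refine Nat.card_eq_of_bijective (fun p => ⟨(Equiv.sumCongr p.1.2.1 p.2.1).trans
    (finSumEquivOfFinset p.1.1.2 (hc _ p.1.1.2)), ?_⟩) ⟨?_, ?_⟩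
  · rintro (a | a) (b | b) hab
    · simpa using p.1.2.2 a b hab
    · exact absurd hab (h₁ _ _)
    · exact absurd hab (h₂ _ _)
    · simpa using p.2.2 a b hab
  · rintro ⟨⟨⟨s, hs⟩, e, he⟩, f, hf⟩ ⟨⟨⟨s', hs'⟩, e', he'⟩, f', hf'⟩ h
    have hl : ∀ a, s.orderEmbOfFin hs (e a) = s'.orderEmbOfFin hs' (e' a) := fun a => by
      simpa using congrArg (fun g => g.1 (.inl a)) h
    have hr : ∀ a, sᶜ.orderEmbOfFin (hc _ hs) (f a) = s'ᶜ.orderEmbOfFin (hc _ hs') (f' a) :=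
      fun a => by simpa using congrArg (fun g => g.1 (.inr a)) h
    obtain rfl : s = s' := by
      refine Finset.eq_of_subset_of_card_le (fun x hx => ?_) (by omega)
      obtain ⟨i, rfl⟩ : x ∈ Set.range (s.orderEmbOfFin hs) := by simpa using hx
      obtain ⟨a, rfl⟩ := e.surjective i
      rw [hl]
      exact Finset.orderEmbOfFin_mem _ _ _
    obtain rfl : e = e' := Equiv.ext fun a => by simpa using hl a
    obtain rfl : f = f' := Equiv.ext fun a => by simpa using hr a
    rfl
  · rintro ⟨e, he⟩
    let _ : Fintype α := Fintype.ofEquiv _ eα.symm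
    let _ : Fintype β := Fintype.ofEquiv _ eβ.symm
    have hk : Fintype.card β = k := by simpa using Fintype.card_congr eβ
    have hm : Fintype.card α = m := by simpa using Fintype.card_congr eα
    set s : Finset (Fin (m + k)) :=
      Finset.univ.map (Function.Embedding.inl.trans e.toEmbedding) with hsdef
    have hs : s.card = m := by simp [hsdef, hm]
    have hmem : ∀ a, e (.inl a) ∈ s := fun a => by simp [hsdef]
    have hmem' : ∀ b, e (.inr b) ∈ sᶜ := fun b => by simp [hsdef]
    let g₁ : α → Fin m := fun a => (s.orderIsoOfFin hs).symm ⟨_, hmem a⟩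
    let g₂ : β → Fin k := fun b => (sᶜ.orderIsoOfFin (hc s hs)).symm ⟨_, hmem' b⟩
    have hg₁ : g₁.Injective := fun a b hab => by simpa [g₁] using hab
    have hg₂ : g₂.Injective := fun a b hab => by simpa [g₂] using hab
    have b₁ : g₁.Bijective := (Fintype.bijective_iff_injective_and_card _).2 ⟨hg₁, by simp [hm]⟩
    have b₂ : g₂.Bijective := (Fintype.bijective_iff_injective_and_card _).2 ⟨hg₂, by simp [hk]⟩
    refine ⟨⟨⟨⟨s, hs⟩, Equiv.ofBijective g₁ b₁, fun a b hab => ?_⟩,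
      Equiv.ofBijective g₂ b₂, fun a b hab => ?_⟩, ?_⟩
    · simpa [g₁] using he _ _ hab
    · simpa [g₂] using he _ _ hab
    · apply Subtype.ext
      apply Equiv.ext
      rintro (a | a)
      · simp [g₁, ← Finset.coe_orderIsoOfFin_apply]
      · simp [g₂, ← Finset.coe_orderIsoOfFin_apply]

/-- The covering relations `0 < 2 > 1 < 3 < 5 > 4 < 6 < ⋯` on `ℕ`. -/
def zigzag (a b : ℕ) : Prop :=
  (a % 3 = 1 ∧ (b = a + 1 ∨ b = a + 2)) ∨ (a % 3 = 0 ∧ b = a + 2)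

theorem LScount_eq_linExtCount (n : ℕ) :
    LScount n = linExtCount (fun a b : Fin (3 * n + 1) => zigzag a b) (3 * n + 1) := by
  rw [LScount, LSset, ← Fintype.card_subtype, ← Nat.card_eq_fintype_card]
  refine Nat.card_congr (Equiv.subtypeEquivRight fun σ => ⟨?_, fun h => ⟨?_, ?_, ?_⟩⟩)
  · rintro ⟨h₁, h₂, h₃⟩ ⟨a, ha⟩ ⟨b, hb⟩ hab
    simp only [zigzag] at hab
    rcases hab with ⟨h3, rfl | rfl⟩ | ⟨h3, rfl⟩
    · obtain ⟨i, rfl⟩ : ∃ i, a = 3 * i + 1 := ⟨a / 3, by omega⟩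
      exact (h₁ i (by omega)).choose_spec.1
    · obtain ⟨i, rfl⟩ : ∃ i, a = 3 * i + 1 := ⟨a / 3, by omega⟩
      exact (h₁ i (by omega)).choose_spec.2
    · obtain ⟨i, rfl⟩ : ∃ i, a = 3 * i := ⟨a / 3, by omega⟩
      rcases Nat.eq_zero_or_pos i with rfl | hi
      · exact h₃ (by omega)
      · exact (h₂ i (by omega) hi).choose_spec
  · exact fun i hi => ⟨by omega, h _ _ (by simp only [zigzag, true_or, and_true]; omega),
      h _ _ (by simp only [zigzag, or_true, and_true]; omega)⟩
  · exact fun i hi _ => ⟨by omega, h _ _ (by simp only [zigzag, or_true, and_true]; omega)⟩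
  · exact fun _ => h _ _ (by simp [zigzag])

theorem LAcount_eq_linExtCount (n : ℕ) :
    LAcount n = linExtCount (fun a b : Fin (3 * n) => zigzag (a + 1) (b + 1)) (3 * n) := by
  rw [LAcount, LAset, ← Fintype.card_subtype, ← Nat.card_eq_fintype_card]
  refine Nat.card_congr (Equiv.subtypeEquivRight fun σ => ⟨?_, fun h => ⟨?_, ?_⟩⟩)
  · rintro ⟨h₁, h₂⟩ ⟨a, ha⟩ ⟨b, hb⟩ hab
    simp only [zigzag] at hab
    rcases hab with ⟨h3, h | h⟩ | ⟨h3, h⟩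
    · obtain ⟨i, rfl⟩ : ∃ i, a = 3 * i := ⟨a / 3, by omega⟩
      obtain rfl : b = 3 * i + 1 := by omega
      exact (h₁ i (by omega)).choose_spec.1
    · obtain ⟨i, rfl⟩ : ∃ i, a = 3 * i := ⟨a / 3, by omega⟩
      obtain rfl : b = 3 * i + 2 := by omega
      exact (h₁ i (by omega)).choose_spec.2
    · obtain ⟨i, hi, rfl⟩ : ∃ i, 1 ≤ i ∧ a = 3 * i - 1 := ⟨(a + 1) / 3, by omega, by omega⟩
      obtain rfl : b = 3 * i + 1 := by omega
      exact (h₂ i (by omega) hi).choose_spec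
  · exact fun i hi => ⟨by omega, h _ _ (by simp only [zigzag, true_or, and_true]; omega),
      h _ _ (by simp only [zigzag, or_true, and_true]; omega)⟩
  · exact fun i hi _ => ⟨by omega, h _ _ (by simp only [zigzag]; omega)⟩

theorem LBcount_eq_linExtCount (n : ℕ) :
    LBcount n = linExtCount (fun a b : Fin (3 * n + 2) =>
      zigzag (if a.val = 3 * n + 1 then 3 * n + 2 else a)
        (if b.val = 3 * n + 1 then 3 * n + 2 else b)) (3 * n + 2) := by
  rw [LBcount, LBset, ← Fintype.card_subtype, ← Nat.card_eq_fintype_card]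
  refine Nat.card_congr (Equiv.subtypeEquivRight fun σ => ⟨?_, fun h => ⟨?_, ?_, ?_, ?_⟩⟩)
  · rintro ⟨h₁, h₂, h₃, h₄⟩ ⟨a, ha⟩ ⟨b, hb⟩ hab
    simp only [zigzag] at hab
    rcases hab with ⟨h3, h | h⟩ | ⟨h3, h⟩
    · obtain ⟨i, rfl⟩ : ∃ i, a = 3 * i + 1 := ⟨a / 3, by split_ifs at * <;> omega⟩
      obtain rfl : b = 3 * i + 2 := by split_ifs at * <;> omega
      exact (h₁ i (by omega)).choose_spec.1
    · obtain ⟨i, rfl⟩ : ∃ i, a = 3 * i + 1 := ⟨a / 3, by split_ifs at * <;> omega⟩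
      have hi : i < n := by split_ifs at * <;> omega
      obtain rfl : b = 3 * i + 3 := by split_ifs at * <;> omega
      exact (h₁ i hi).choose_spec.2
    · obtain ⟨i, rfl⟩ : ∃ i, a = 3 * i := ⟨a / 3, by split_ifs at * <;> omega⟩
      rcases (show i ≤ n by omega).eq_or_lt with rfl | hin
      · obtain rfl : b = 3 * i + 1 := by split_ifs at * <;> omega
        exact h₄
      obtain rfl : b = 3 * i + 2 := by split_ifs at * <;> omega
      rcases Nat.eq_zero_or_pos i with rfl | hi
      · exact h₃ (by omega)
      · exact (h₂ i hin hi).choose_spec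
  · exact fun i hi => ⟨by omega, h _ _ (by simp only [zigzag]; split_ifs <;> omega),
      h _ _ (by simp only [zigzag]; split_ifs <;> omega)⟩
  · exact fun i hi _ => ⟨by omega, h _ _ (by simp only [zigzag]; split_ifs <;> omega)⟩
  · exact fun hn => h _ _ (by
      simp only [zigzag]
      rw [if_neg (by omega), if_neg (by omega)]
      simp)
  · exact h _ _ (by simp only [zigzag]; split_ifs <;> omega)

/-- Linear extensions of the zigzag on `Fin (m + 1)` whose minimum sits at position `x`. -/
noncomputable def zigzagCountAt (m x : ℕ) : ℕ :=
  Nat.card {e : Fin (m + 1) ≃ Fin (m + 1) //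
    (∀ a b : Fin (m + 1), zigzag a b → e a < e b) ∧ (e.symm 0).val = x}

theorem linExtCount_zigzag_eq_sum (m : ℕ) :
    linExtCount (fun a b : Fin (m + 1) => zigzag a b) (m + 1) =
      ∑ x ∈ Finset.range (m + 1), zigzagCountAt m x := by
  classical
  simp only [linExtCount, zigzagCountAt, Nat.card_eq_fintype_card, Fintype.card_subtype]
  rw [Finset.card_eq_sum_card_fiberwise (t := Finset.range (m + 1))
    (f := fun e : Fin (m + 1) ≃ Fin (m + 1) => (e.symm 0).val)]
  · simp only [Finset.filter_filter]
  · intro e _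
    simpa using (e.symm 0).is_le

theorem zigzagCountAt_eq_zero {m x y : ℕ} (h : zigzag y x) (hyx : y < x) :
    zigzagCountAt m x = 0 := by
  rw [zigzagCountAt, Nat.card_eq_zero]
  refine .inl ⟨fun ⟨e, he, hx⟩ => ?_⟩
  have hlt := he ⟨y, by omega⟩ (e.symm 0) (by rw [hx]; exact h)
  simp at hlt

theorem zigzagCountAt_eq_linExtCount {β : Type*} {m : ℕ} (f : Option β ≃ Fin (m + 1))
    (hf : ∀ y, ¬ zigzag y (f none)) :
    zigzagCountAt m (f none) =
      linExtCount (fun a b : β => zigzag (f (some a)) (f (some b))) m := by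
  rw [← card_linExt_none_eq_zero (fun a b => zigzag (f a) (f b)) (fun x => hf _)]
  refine Nat.card_congr ((Equiv.equivCongr f.symm (Equiv.refl _)).subtypeEquiv fun e => ?_)
  refine and_congr ?_ ?_
  · simp [f.symm.forall_congr_left]
  · rw [← Fin.ext_iff, Equiv.symm_apply_eq]
    simp [eq_comm]

theorem zigzagCountAt_zero (n : ℕ) : zigzagCountAt (3 * n) 0 = LAcount n := by
  rw [LAcount_eq_linExtCount]
  have := zigzagCountAt_eq_linExtCount (finSuccEquiv (3 * n)).symm
    (fun y => by simp [zigzag])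
  simpa using this

theorem zigzagCountAt_valley (j l : ℕ) :
    zigzagCountAt (3 * (j + l + 1)) (3 * j + 1) =
      (3 * (j + l + 1)).choose (3 * j + 2) * LBcount j * LScount l := by
  let g : Option (Fin (3 * j + 2) ⊕ Fin (3 * l + 1)) → Fin (3 * (j + l + 1) + 1)
    | none => ⟨3 * j + 1, by omega⟩
    | some (.inl a) => ⟨if a.val = 3 * j + 1 then 3 * j + 2 else a, by split_ifs <;> omega⟩
    | some (.inr b) => ⟨3 * j + 3 + b, by omega⟩
  have hg : g.Bijective := by
    rw [Fintype.bijective_iff_injective_and_card]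
    refine ⟨?_, by simp; ring⟩
    rintro (_ | a | a) (_ | b | b) hab <;> simp only [g, Fin.mk.injEq] at hab
    all_goals first
      | rfl
      | (exfalso; omega)
      | (exfalso; split_ifs at hab <;> omega)
      | (congr 2; ext; omega)
      | (congr 2; ext; split_ifs at hab <;> omega)
  have key := zigzagCountAt_eq_linExtCount (Equiv.ofBijective g hg)
    (fun y => by simp only [zigzag, Equiv.ofBijective_apply, g]; omega)
  have hm : 3 * (j + l + 1) = (3 * j + 2) + (3 * l + 1) := by ring
  rw [LBcount_eq_linExtCount, LScount_eq_linExtCount]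
  calc _ = _ := key
    _ = linExtCount _ ((3 * j + 2) + (3 * l + 1)) := by rw [← hm]
    _ = _ := linExtCount_sum _ ?_ ?_ (Equiv.refl _) (Equiv.refl _)
    _ = _ := ?_
  · intro a b
    simp only [zigzag, Equiv.ofBijective_apply, g]
    split_ifs <;> omega
  · intro a b
    simp only [zigzag, Equiv.ofBijective_apply, g]
    split_ifs <;> omega
  · rw [← hm]
    congr 1
    refine linExtCount_congr (Equiv.refl _) (fun a b => ?_) _
    simp only [zigzag, Equiv.ofBijective_apply, Equiv.refl_apply, g]
    omega

theorem sum_range_three_mul (f : ℕ → ℕ) (n : ℕ) :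
    ∑ x ∈ Finset.range (3 * n), f x =
      ∑ i ∈ Finset.range n, (f (3 * i) + f (3 * i + 1) + f (3 * i + 2)) := by
  induction n with
  | zero => simp
  | succ n ih =>
    rw [Finset.sum_range_succ, ← ih, show 3 * (n + 1) = 3 * n + 1 + 1 + 1 by ring,
      Finset.sum_range_succ, Finset.sum_range_succ, Finset.sum_range_succ]
    ring

theorem LS_rec (n : ℕ) (hn : 1 ≤ n) :
    LScount n = LAcount n + ∑ k ∈ Finset.Icc 1 n,
      Nat.choose (3*n) (3*k-1) * LBcount (k-1) * LScount (n-k) := by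
  rw [LScount_eq_linExtCount, linExtCount_zigzag_eq_sum, Finset.sum_range_succ',
    sum_range_three_mul, zigzagCountAt_zero, add_comm, ← Finset.Ico_add_one_right_eq_Icc,
    Finset.sum_Ico_eq_sum_range, Nat.add_sub_cancel]
  refine congrArg _ (Finset.sum_congr rfl fun j hj => ?_)
  obtain ⟨l, rfl⟩ : ∃ l, n = j + l + 1 :=
    ⟨n - j - 1, by have := Finset.mem_range.1 hj; omega⟩
  have h₂ : zigzagCountAt (3 * (j + l + 1)) (3 * j + 1 + 1) = 0 :=
    zigzagCountAt_eq_zero (y := 3 * j) (by simp only [zigzag, or_true, and_true]; omega) (by omega)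
  have h₃ : zigzagCountAt (3 * (j + l + 1)) (3 * j + 2 + 1) = 0 :=
    zigzagCountAt_eq_zero (y := 3 * j + 1) (by simp only [zigzag, or_true, and_true]; omega)
      (by omega)
  rw [h₂, h₃, zigzagCountAt_valley, show 3 * (1 + j) - 1 = 3 * j + 2 by omega,
    show 1 + j - 1 = j by omega, add_zero, add_zero, show j + l + 1 - (1 + j) = l by omega]
end

section
/- For every n ≥ 1, LE_n = Σ_{k=1}^{n} C(3n, 3k−2) · LE_{k−1} · LB_{n−k}, where C(m,r) denotes the binomial coefficient. -/
/-- Bijective labellings of `ι` by `α` that are strictly increasing along the relation `r`. -/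
abbrev IncLabelling {ι : Type*} (r : ι → ι → Prop) (α : Type*) [LT α] : Type _ :=
  {f : ι ≃ α // ∀ i j, r i j → f i < f j}

namespace IncLabelling

variable {ι κ α β : Type*}

instance [Finite ι] [LT α] (r : ι → ι → Prop) : Finite (IncLabelling r α) := by
  by_cases h : Nonempty (ι ≃ α)
  · have : Finite α := Finite.of_equiv ι h.some
    exact Subtype.finite
  · exact @Finite.of_subsingleton _ ⟨fun f => (h ⟨f.1⟩).elim⟩

/-- Relabelling along an order isomorphism. -/
def congrRight [Preorder α] [Preorder β] (r : ι → ι → Prop) (e : α ≃o β) :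
    IncLabelling r α ≃ IncLabelling r β :=
  (Equiv.equivCongr (Equiv.refl ι) e.toEquiv).subtypeEquiv fun f => by simp

theorem card_eq_fin [LinearOrder α] [Fintype α] (r : ι → ι → Prop) {N : ℕ}
    (h : Fintype.card α = N) :
    Nat.card (IncLabelling r α) = Nat.card (IncLabelling r (Fin N)) :=
  Nat.card_congr (congrRight r (Fintype.orderIsoFinOfCardEq α h)).symm

/-- Labellings of a disjoint union whose left summand receives exactly the labels in `S`. -/
noncomputable def sumFiberEquiv [LT α] [DecidableEq α] (r : ι → ι → Prop) (s : κ → κ → Prop) (S : Finset α) :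
    {f : IncLabelling (Sum.LiftRel r s) α // ∀ x, x.isLeft ↔ f.1 x ∈ S} ≃
      IncLabelling r {a // a ∈ S} × IncLabelling s {a // a ∉ S} where
  toFun f :=
    (⟨(Equiv.ofBijective (fun i => ⟨f.1.1 (.inl i), (f.2 _).1 rfl⟩) (by
        refine ⟨fun i j h => by simpa using h, fun a => ?_⟩
        obtain ⟨x, hx⟩ := f.1.1.surjective a.1
        have := (f.2 x).2 (hx ▸ a.2)
        rcases x with x | x
        · exact ⟨x, Subtype.ext hx⟩
        · simp at this)), fun i j h => f.1.2 _ _ (.inl h)⟩,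
     ⟨(Equiv.ofBijective (fun i => ⟨f.1.1 (.inr i), fun h => by simpa using (f.2 _).2 h⟩) (by
        refine ⟨fun i j h => by simpa using h, fun a => ?_⟩
        obtain ⟨x, hx⟩ := f.1.1.surjective a.1
        rcases x with x | x
        · exact (a.2 (hx ▸ (f.2 (.inl x)).1 rfl)).elim
        · exact ⟨x, Subtype.ext hx⟩)), fun i j h => f.1.2 _ _ (.inr h)⟩)
  invFun g :=
    ⟨⟨(Equiv.sumCongr g.1.1 g.2.1).trans (Equiv.sumCompl (· ∈ S)), by
        rintro _ _ (h | h)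
        · exact g.1.2 _ _ h
        · exact g.2.2 _ _ h⟩, by
      rintro (x | x)
      · simp
      · simpa using (g.2.1 x).2⟩
  left_inv f := by
    apply Subtype.ext
    apply Subtype.ext
    ext (x | x) <;> rfl
  right_inv g := by
    refine Prod.ext (Subtype.ext ?_) (Subtype.ext ?_) <;> ext x <;> rfl

theorem card_sum [Fintype ι] [Fintype κ] [LinearOrder α] [Fintype α] (r : ι → ι → Prop)
    (s : κ → κ → Prop) {p q : ℕ} (hι : Fintype.card ι = p) (hκ : Fintype.card κ = q)
    (h : Fintype.card α = p + q) :
    Nat.card (IncLabelling (Sum.LiftRel r s) α) =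
      (p + q).choose p * Nat.card (IncLabelling r (Fin p)) *
        Nat.card (IncLabelling s (Fin q)) := by
  subst hι hκ
  classical
  let im : IncLabelling (Sum.LiftRel r s) α → Finset α :=
    fun f => Finset.univ.image fun i => f.1 (.inl i)
  have him (S) (f : IncLabelling (Sum.LiftRel r s) α) :
      im f = S ↔ ∀ x, x.isLeft ↔ f.1 x ∈ S := by
    constructor
    · rintro rfl (x | x) <;> simp [im]
    · intro hf
      ext a
      obtain ⟨x, rfl⟩ := f.1.surjective a
      rw [← hf]
      rcases x with x | x <;> simp [im]
  have hcard (S : Finset α) : Nat.card {f // im f = S} =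
      if S ∈ Finset.powersetCard (Fintype.card ι) Finset.univ then
        Nat.card (IncLabelling r (Fin (Fintype.card ι))) *
          Nat.card (IncLabelling s (Fin (Fintype.card κ))) else 0 := by
    split_ifs with hS
    · rw [Finset.mem_powersetCard_univ] at hS
      rw [Nat.card_congr ((Equiv.subtypeEquivRight (him S)).trans (sumFiberEquiv r s S)),
        Nat.card_prod, card_eq_fin r (by simpa using hS),
        card_eq_fin s (N := Fintype.card κ) (by
          rw [Fintype.card_subtype_compl, Fintype.card_coe]; omega)]
    · rw [Finset.mem_powersetCard_univ] at hS
      have : IsEmpty {f // im f = S} := by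
        refine ⟨fun f => hS ?_⟩
        rw [← f.2]
        exact (Finset.card_image_of_injective _
          (f.1.1.injective.comp Sum.inl_injective)).trans Finset.card_univ
      exact Nat.card_of_isEmpty
  rw [Nat.card_congr (Equiv.sigmaFiberEquiv im).symm, Nat.card_sigma]
  simp only [hcard]
  rw [Finset.sum_ite_mem, Finset.univ_inter, Finset.sum_const, Finset.card_powersetCard,
    Finset.card_univ, h, smul_eq_mul, mul_assoc]

/-- Deleting a minimal element that carries the least label. -/
def deleteMin [LinearOrder α] [OrderBot α] (r : κ → κ → Prop) (u : Option ι ≃ κ)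
    (hu : ∀ x, ¬ r x (u none)) :
    {f : IncLabelling r α // f.1 (u none) = ⊥} ≃
      IncLabelling (fun i j => r (u (some i)) (u (some j))) {a : α // a ≠ ⊥} where
  toFun f := ⟨(Equiv.optionSubtype (⊥ : α)) ⟨u.trans f.1.1, f.2⟩, fun i j h => f.1.2 _ _ h⟩
  invFun g :=
    ⟨⟨u.symm.trans ((Equiv.optionSubtype (⊥ : α)).symm g.1).1, by
      intro i j h
      obtain ⟨i, rfl⟩ := u.surjective i
      obtain ⟨j, rfl⟩ := u.surjective j
      rcases j with _ | j
      · exact (hu _ h).elim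
      rcases i with _ | i
      · simpa [bot_lt_iff_ne_bot] using (g.1 j).2
      · simpa using g.2 i j h⟩, by simp⟩
  left_inv f := by
    apply Subtype.ext
    apply Subtype.ext
    ext x
    simp
  right_inv g := by
    apply Subtype.ext
    ext x
    simp

end IncLabelling

/-- The relation defining `LEset n`, on positions. -/
def relE (n : ℕ) (i j : Fin (3 * n + 1)) : Prop :=
  (i.1 % 3 = 0 ∧ (j.1 = i + 1 ∨ j.1 = i + 2)) ∨ (i.1 % 3 = 2 ∧ j.1 = i + 2) ∨
    (i.1 + 1 = 3 * n ∧ j.1 = 3 * n)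

/-- The relation defining `LBset n`, on positions. -/
def relB (n : ℕ) (i j : Fin (3 * n + 2)) : Prop :=
  (i.1 % 3 = 1 ∧ (j.1 = i + 1 ∨ j.1 = i + 2)) ∨ (i.1 % 3 = 0 ∧ j.1 = i + 2) ∨
    (i.1 = 3 * n ∧ j.1 = 3 * n + 1)

theorem mem_LEset {n : ℕ} {σ : Equiv.Perm (Fin (3 * n + 1))} :
    σ ∈ LEset n ↔ ∀ i j, relE n i j → σ i < σ j := by
  simp only [LEset, Finset.mem_filter, Finset.mem_univ, true_and]
  constructor
  · rintro ⟨h₁, h₂, h₃⟩ ⟨i, hi⟩ ⟨j, hj⟩ (⟨h, rfl | rfl⟩ | ⟨h, rfl⟩ | ⟨h, rfl⟩)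
    · obtain ⟨t, rfl⟩ : ∃ t, i = 3 * t := ⟨i / 3, by simp at h; omega⟩
      exact (h₁ t (by simp at hj; omega)).2.1
    · obtain ⟨t, rfl⟩ : ∃ t, i = 3 * t := ⟨i / 3, by simp at h; omega⟩
      exact (h₁ t (by simp at hj; omega)).2.2
    · obtain ⟨t, rfl⟩ : ∃ t, i = 3 * (t + 1) - 1 := ⟨i / 3, by simp at h; omega⟩
      convert (h₂ (t + 1) (by simp at hj; omega) (by omega)).2 using 3
      simp; omega
    · obtain rfl : i = 3 * n - 1 := by simp at h; omega
      exact h₃ (by simp at h; omega)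
  · intro h
    refine ⟨fun i hi => ⟨by omega, h _ _ ?_, h _ _ ?_⟩,
      fun i hi hi' => ⟨by omega, h _ _ ?_⟩, fun hn => h _ _ ?_⟩ <;> simp only [relE] <;> grind

theorem mem_LBset {n : ℕ} {σ : Equiv.Perm (Fin (3 * n + 2))} :
    σ ∈ LBset n ↔ ∀ i j, relB n i j → σ i < σ j := by
  simp only [LBset, Finset.mem_filter, Finset.mem_univ, true_and]
  constructor
  · rintro ⟨h₁, h₂, h₃, h₄⟩ ⟨i, hi⟩ ⟨j, hj⟩ (⟨h, rfl | rfl⟩ | ⟨h, rfl⟩ | ⟨rfl, rfl⟩)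
    · obtain ⟨t, rfl⟩ : ∃ t, i = 3 * t + 1 := ⟨i / 3, by simp at h; omega⟩
      exact (h₁ t (by simp at hj; omega)).2.1
    · obtain ⟨t, rfl⟩ : ∃ t, i = 3 * t + 1 := ⟨i / 3, by simp at h; omega⟩
      exact (h₁ t (by simp at hj; omega)).2.2
    · obtain ⟨t, rfl⟩ : ∃ t, i = 3 * t := ⟨i / 3, by simp at h; omega⟩
      rcases Nat.eq_zero_or_pos t with rfl | ht
      · exact h₃ (by simp at hj; omega)
      · exact (h₂ t (by simp at hj; omega) ht).2
    · exact h₄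
  · intro h
    refine ⟨fun i hi => ⟨by omega, h _ _ ?_, h _ _ ?_⟩,
      fun i hi hi' => ⟨by omega, h _ _ ?_⟩, fun hn => h _ _ ?_, h _ _ ?_⟩ <;>
      simp only [relB] <;> grind

theorem LEcount_eq_card (n : ℕ) :
    LEcount n = Nat.card (IncLabelling (relE n) (Fin (3 * n + 1))) := by
  rw [LEcount, ← Nat.card_eq_finsetCard]
  exact Nat.card_congr (Equiv.subtypeEquivRight fun _ => mem_LEset)

theorem LBcount_eq_card (n : ℕ) :
    LBcount n = Nat.card (IncLabelling (relB n) (Fin (3 * n + 2))) := by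
  rw [LBcount, ← Nat.card_eq_finsetCard]
  exact Nat.card_congr (Equiv.subtypeEquivRight fun _ => mem_LBset)

/-- The positions of `E_{a+1+b}`, split into the minimal position `3a` and the positions of the
components `E_a` and `B_b` left after its deletion. -/
noncomputable def splitE (a b : ℕ) :
    Option (Fin (3 * a + 1) ⊕ Fin (3 * b + 2)) ≃ Fin (3 * (a + 1 + b) + 1) :=
  Equiv.ofBijective
    (fun
      | none => ⟨3 * a, by omega⟩
      | some (.inl i) => ⟨if i.1 < 3 * a then i else 3 * a + 1, by split_ifs <;> omega⟩
      | some (.inr j) => ⟨3 * a + 2 + j, by omega⟩) <| by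
    rw [Fintype.bijective_iff_injective_and_card]
    refine ⟨?_, by simp; omega⟩
    rintro (_ | i | i) (_ | j | j) h <;> simp only [Fin.mk.injEq] at h <;>
      (try split_ifs at h) <;> simp [Fin.ext_iff] <;> omega

theorem card_min_eq (a b : ℕ) :
    Nat.card {f : IncLabelling (relE (a + 1 + b)) (Fin (3 * (a + 1 + b) + 1)) //
      f.1 (splitE a b none) = ⊥} =
    (3 * (a + 1 + b)).choose (3 * a + 1) * LEcount a * LBcount b := by
  have hrel : (fun i j => relE (a + 1 + b) (splitE a b (some i)) (splitE a b (some j))) =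
      Sum.LiftRel (relE a) (relB b) := by
    ext (i | i) (j | j) <;>
      simp only [Sum.liftRel_inl_inl, Sum.liftRel_inr_inr, Sum.not_liftRel_inl_inr,
        Sum.not_liftRel_inr_inl, relE, relB, splitE, Equiv.ofBijective_apply] <;>
      (try split_ifs) <;> grind
  rw [Nat.card_congr (IncLabelling.deleteMin _ _ _), hrel,
      IncLabelling.card_sum _ _ (Fintype.card_fin _) (Fintype.card_fin _) (by simp; omega),
      LEcount_eq_card, LBcount_eq_card]
  · congr 3
    omega
  · rintro ⟨x, hx⟩
    simp only [relE, splitE, Equiv.ofBijective_apply]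
    omega

theorem LE_rec (n : ℕ) (hn : 1 ≤ n) :
    LEcount n = ∑ k ∈ Finset.Icc 1 n,
      Nat.choose (3*n) (3*k-2) * LEcount (k-1) * LBcount (n-k) := by
  rw [LEcount_eq_card, Nat.card_congr (Equiv.sigmaFiberEquiv
    fun f : IncLabelling (relE n) (Fin (3 * n + 1)) => f.1.symm ⊥).symm, Nat.card_sigma]
  symm
  apply Finset.sum_of_injOn fun k => Fin.ofNat (3 * n + 1) (3 * (k - 1))
  · intro k hk l hl h
    simp only [Finset.coe_Icc, Set.mem_Icc] at hk hl
    simp only [Fin.ext_iff, Fin.val_ofNat] at h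
    rw [Nat.mod_eq_of_lt (by omega), Nat.mod_eq_of_lt (by omega)] at h
    omega
  · simp
  · intro i _ hi
    rw [Nat.card_eq_zero]
    left
    refine ⟨fun ⟨f, hf⟩ => ?_⟩
    rw [Equiv.symm_apply_eq] at hf
    have hmin (j) : ¬ relE n j i := fun h => not_lt_bot (hf ▸ f.2 _ _ h)
    by_cases h0 : i.1 % 3 = 0 ∧ i.1 ≠ 3 * n
    · refine hi ⟨i.1 / 3 + 1, ?_, ?_⟩
      · simp; omega
      · simp only [Fin.ext_iff, Fin.val_ofNat]
        rw [Nat.mod_eq_of_lt (by omega)]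
        omega
    · apply hmin ⟨if i.1 = 3 * n then i - 1 else if i.1 % 3 = 1 then i - 1 else i - 2, by
        split_ifs <;> omega⟩
      simp only [relE]
      split_ifs <;> omega
  · intro k hk
    obtain ⟨a, rfl⟩ : ∃ a, k = a + 1 := ⟨k - 1, by simp at hk; omega⟩
    obtain ⟨b, rfl⟩ : ∃ b, n = a + 1 + b := ⟨n - (a + 1), by simp at hk; omega⟩
    rw [Nat.add_sub_cancel, Nat.add_sub_cancel_left, show 3 * (a + 1) - 2 = 3 * a + 1 by omega,
      ← card_min_eq]
    refine Nat.card_congr (Equiv.subtypeEquivRight fun f => ?_)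
    rw [Equiv.symm_apply_eq, eq_comm]
    convert Iff.rfl using 3
    simp only [Fin.ext_iff, Fin.val_ofNat, splitE, Equiv.ofBijective_apply]
    rw [Nat.mod_eq_of_lt (by omega)]
end

section
/- Every σ ∈ SF_n satisfies ris(σ) ≥ n, and in the ring ℚ[[t]] the following identity holds: (1 + Σ_{n≥1} (t^{3n}/(3n)!) · #{σ ∈ SF_n : ris(σ) = n}) · (1 + Σ_{n≥1} ((−1)^n t^{3n}/(3n)!) · Π_{k=1}^{n} (3k−2)) = 1. Equivalently, the exponential generating function for binary-shrub-forest permutations with the minimal number n of rises equals 1/(1 + Σ_{n≥1} ((−1)^n t^{3n}/(3n)!) Π_{k=1}^n (3k−2)). -/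
/-- `SF n`: binary-shrub-forest permutations of size `n`, modeled as permutations of
`Fin (3*n)` (0-based; position `p` corresponds to 1-based position `p+1`):
for every `0 ≤ i ≤ n-1`, `σ(3i+1) < σ(3i+2)` and `σ(3i+1) < σ(3i+3)` (1-based). -/
def SF (n : ℕ) : Finset (Equiv.Perm (Fin (3*n))) :=
  Finset.univ.filter fun σ =>
    ∀ i < n, ∃ h : 3*i+2 < 3*n,
      σ ⟨3*i, by omega⟩ < σ ⟨3*i+1, by omega⟩ ∧ σ ⟨3*i, by omega⟩ < σ ⟨3*i+2, h⟩

/-- `ris σ` = number of `j ∈ {1,…,m-1}` (1-based) with `σ(j) < σ(j+1)`. -/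
def ris {m : ℕ} (σ : Equiv.Perm (Fin m)) : ℕ :=
  ((Finset.range m).filter fun j => ∃ h : j + 1 < m, σ ⟨j, by omega⟩ < σ ⟨j+1, h⟩).card

/-- The EGF `1 + Σ_{n≥1} (t^(3n)/(3n)!) ⋅ #{σ ∈ SF n : ris σ = n}` in `ℚ[[t]]`. -/
noncomputable def Mser : PowerSeries ℚ :=
  PowerSeries.mk fun m =>
    if m = 0 then 1
    else if m % 3 = 0 then
      (((SF (m / 3)).filter fun σ => ris σ = m / 3).card : ℚ) / m.factorial
    else 0

/-- The series `1 + Σ_{n≥1} ((-1)^n t^(3n)/(3n)!) Π_{k=1}^n (3k-2)` in `ℚ[[t]]`. -/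
noncomputable def Nser : PowerSeries ℚ :=
  PowerSeries.mk fun m =>
    if m = 0 then 1
    else if m % 3 = 0 then
      (-1) ^ (m / 3) * (∏ k ∈ Finset.Icc 1 (m / 3), (3 * (k : ℚ) - 2)) / m.factorial
    else 0

/-- The one-line notation of `σ` as a function on `ℕ`, extended by zero. -/
def permVal {m : ℕ} (σ : Equiv.Perm (Fin m)) (i : ℕ) : ℕ :=
  if h : i < m then (σ ⟨i, h⟩ : ℕ) else 0

theorem permVal_of_lt {m : ℕ} (σ : Equiv.Perm (Fin m)) {i : ℕ} (h : i < m) :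
    permVal σ i = (σ ⟨i, h⟩ : ℕ) := dif_pos h

theorem permVal_lt {m : ℕ} (σ : Equiv.Perm (Fin m)) {i : ℕ} (h : i < m) :
    permVal σ i < m := by
  rw [permVal_of_lt σ h]; exact (σ _).2

theorem permVal_inj {m : ℕ} (σ : Equiv.Perm (Fin m)) {i j : ℕ} (hi : i < m) (hj : j < m) :
    permVal σ i = permVal σ j ↔ i = j := by
  rw [permVal_of_lt σ hi, permVal_of_lt σ hj, Fin.val_inj, σ.injective.eq_iff, Fin.mk.injEq]

theorem exists_permVal_eq {m : ℕ} (σ : Equiv.Perm (Fin m)) {x : ℕ} (h : x < m) :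
    ∃ i < m, permVal σ i = x :=
  ⟨σ.symm ⟨x, h⟩, (σ.symm ⟨x, h⟩).2, by simp [permVal]⟩

theorem exists_val_lt_iff {m : ℕ} (σ : Equiv.Perm (Fin m)) (j : ℕ) :
    (∃ h : j + 1 < m, σ ⟨j, by omega⟩ < σ ⟨j + 1, h⟩) ↔
      j + 1 < m ∧ permVal σ j < permVal σ (j + 1) := by
  constructor
  · rintro ⟨h, h'⟩
    refine ⟨h, ?_⟩
    rw [permVal_of_lt σ h, permVal_of_lt σ (by omega : j < m)]
    exact h'
  · rintro ⟨h, h'⟩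
    rw [permVal_of_lt σ h, permVal_of_lt σ (by omega : j < m)] at h'
    exact ⟨h, h'⟩

theorem mem_SF_iff {n : ℕ} (σ : Equiv.Perm (Fin (3 * n))) :
    σ ∈ SF n ↔ ∀ i < n, permVal σ (3 * i) < permVal σ (3 * i + 1) ∧
      permVal σ (3 * i) < permVal σ (3 * i + 2) := by
  simp only [SF, Finset.mem_filter, Finset.mem_univ, true_and]
  refine forall₂_congr fun i hi => ?_
  rw [permVal_of_lt σ (by omega : 3 * i < 3 * n), permVal_of_lt σ (by omega : 3 * i + 1 < 3 * n),
    permVal_of_lt σ (by omega : 3 * i + 2 < 3 * n)]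
  exact ⟨fun ⟨_, h⟩ => h, fun h => ⟨by omega, h⟩⟩

/-- The positions (counted from zero) at which `σ` rises. -/
def risePositions {m : ℕ} (σ : Equiv.Perm (Fin m)) : Finset ℕ :=
  (Finset.range m).filter fun j => j + 1 < m ∧ permVal σ j < permVal σ (j + 1)

theorem ris_eq_card {m : ℕ} (σ : Equiv.Perm (Fin m)) : ris σ = (risePositions σ).card := by
  simp only [ris, risePositions, exists_val_lt_iff]

theorem image_subset_risePositions {n : ℕ} {σ : Equiv.Perm (Fin (3 * n))} (hσ : σ ∈ SF n) :
    (Finset.range n).image (3 * ·) ⊆ risePositions σ := by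
  rw [mem_SF_iff] at hσ
  intro j hj
  obtain ⟨i, hi, rfl⟩ := Finset.mem_image.1 hj
  rw [Finset.mem_range] at hi
  simp only [risePositions, Finset.mem_filter, Finset.mem_range]
  exact ⟨by omega, by omega, (hσ i hi).1⟩

theorem card_image_three_mul (n : ℕ) : ((Finset.range n).image (3 * ·)).card = n := by
  rw [Finset.card_image_of_injective _ (fun a b h => by simpa using h), Finset.card_range]

theorem le_ris_of_mem_SF {n : ℕ} {σ : Equiv.Perm (Fin (3 * n))} (hσ : σ ∈ SF n) : n ≤ ris σ := by
  rw [ris_eq_card]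
  exact (card_image_three_mul n).symm.le.trans (Finset.card_le_card (image_subset_risePositions hσ))

/-- Each of the first `n` blocks of three consecutive values has the relative order `1 3 2`. -/
def IsBlocked (n : ℕ) (v : ℕ → ℕ) : Prop :=
  ∀ i < n, v (3 * i) < v (3 * i + 2) ∧ v (3 * i + 2) < v (3 * i + 1)

/-- Consecutive blocks among the blocks `a, …, b - 1` are separated by a descent. -/
def BlockDesc (a b : ℕ) (v : ℕ → ℕ) : Prop :=
  ∀ i, a ≤ i → i + 1 < b → v (3 * i + 3) < v (3 * i + 2)

/-- Consecutive blocks among the blocks `a, …, b - 1` are separated by an ascent. -/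
def BlockAsc (a b : ℕ) (v : ℕ → ℕ) : Prop :=
  ∀ i, a ≤ i → i + 1 < b → v (3 * i + 2) < v (3 * i + 3)

theorem mem_SF_and_ris_eq_iff {n : ℕ} (σ : Equiv.Perm (Fin (3 * n))) :
    σ ∈ SF n ∧ ris σ = n ↔ IsBlocked n (permVal σ) ∧ BlockDesc 0 n (permVal σ) := by
  constructor
  · rintro ⟨hσ, hr⟩
    have heq : (Finset.range n).image (3 * ·) = risePositions σ :=
      Finset.eq_of_subset_of_card_le (image_subset_risePositions hσ)
        (by rw [card_image_three_mul, ← ris_eq_card, hr])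
    have key : ∀ j, j + 1 < 3 * n → j % 3 ≠ 0 → permVal σ (j + 1) < permVal σ j := by
      intro j hj hj3
      have hnot : j ∉ risePositions σ := by
        rw [← heq, Finset.mem_image]
        rintro ⟨i, -, rfl⟩
        simp at hj3
      simp only [risePositions, Finset.mem_filter, Finset.mem_range, not_and, not_lt] at hnot
      exact lt_of_le_of_ne (hnot (by omega) hj)
        fun h => by rw [permVal_inj σ hj (by omega)] at h; omega
    rw [mem_SF_iff] at hσ
    exact ⟨fun i hi => ⟨(hσ i hi).2, key (3 * i + 1) (by omega) (by omega)⟩,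
      fun i _ hi => key (3 * i + 2) (by omega) (by omega)⟩
  · rintro ⟨hB, hD⟩
    have hσ : σ ∈ SF n := by
      rw [mem_SF_iff]
      exact fun i hi => ⟨(hB i hi).1.trans (hB i hi).2, (hB i hi).1⟩
    refine ⟨hσ, le_antisymm ?_ (le_ris_of_mem_SF hσ)⟩
    rw [ris_eq_card]
    refine (Finset.card_le_card ?_).trans (card_image_three_mul n).le
    intro j hj
    simp only [risePositions, Finset.mem_filter, Finset.mem_range] at hj
    obtain ⟨-, hj, hlt⟩ := hj
    rw [Finset.mem_image]
    refine ⟨j / 3, Finset.mem_range.2 (by omega), ?_⟩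
    have h3 := Nat.mod_lt j (by norm_num : 0 < 3)
    have h1 := hB (j / 3) (by omega)
    have h2 := hD (j / 3) (by omega)
    by_contra hne
    obtain h | h : j = 3 * (j / 3) + 1 ∨ j = 3 * (j / 3) + 2 := by grind
    · rw [h] at hlt
      exact absurd hlt h1.2.not_gt
    · have := h2 (by omega)
      rw [h] at hlt
      exact absurd hlt this.not_gt

/-- The permutation which sends the first `a` positions into `S` with pattern `τ`,
and the last `b` positions into the complement of `S` with pattern `ρ`. -/
def shufflePerm {a b : ℕ}
    (x : {S : Finset (Fin (a + b)) // S.card = a} × Equiv.Perm (Fin a) × Equiv.Perm (Fin b)) :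
    Equiv.Perm (Fin (a + b)) :=
  finSumFinEquiv.symm.trans ((Equiv.sumCongr x.2.1 x.2.2).trans
    (finSumEquivOfFinset x.1.2 (by rw [Finset.card_compl, x.1.2, Fintype.card_fin]; omega)))

section shufflePerm

variable {a b : ℕ}
  (x : {S : Finset (Fin (a + b)) // S.card = a} × Equiv.Perm (Fin a) × Equiv.Perm (Fin b))

theorem shufflePerm_castAdd (i : Fin a) :
    shufflePerm x (Fin.castAdd b i) = x.1.1.orderEmbOfFin x.1.2 (x.2.1 i) := by
  simp [shufflePerm]

theorem shufflePerm_natAdd (i : Fin b) :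
    shufflePerm x (Fin.natAdd a i) = x.1.1ᶜ.orderEmbOfFin
      (by rw [Finset.card_compl, x.1.2, Fintype.card_fin]; omega) (x.2.2 i) := by
  simp [shufflePerm]

theorem shufflePerm_mem_iff (i : Fin (a + b)) : shufflePerm x i ∈ x.1.1 ↔ (i : ℕ) < a := by
  refine Fin.addCases (fun i => ?_) (fun i => ?_) i
  · rw [shufflePerm_castAdd]
    simp [Finset.orderEmbOfFin_mem]
  · rw [shufflePerm_natAdd]
    have := Finset.orderEmbOfFin_mem x.1.1ᶜ
      (by rw [Finset.card_compl, x.1.2, Fintype.card_fin]; omega) (x.2.2 i)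
    rw [Finset.mem_compl] at this
    simp [this]

theorem shufflePerm_injective : Function.Injective (shufflePerm (a := a) (b := b)) := by
  intro x y hxy
  have hS : x.1 = y.1 := by
    ext z
    obtain ⟨i, rfl⟩ := (shufflePerm x).surjective z
    rw [shufflePerm_mem_iff, hxy, shufflePerm_mem_iff]
  obtain ⟨S, τ, ρ⟩ := x
  obtain ⟨S', τ', ρ'⟩ := y
  obtain rfl : S = S' := hS
  have hτ : τ = τ' := by
    ext1 i
    have := DFunLike.congr_fun hxy (Fin.castAdd b i)
    simpa [shufflePerm_castAdd] using this
  have hρ : ρ = ρ' := by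
    ext1 i
    have := DFunLike.congr_fun hxy (Fin.natAdd a i)
    simpa [shufflePerm_natAdd] using this
  rw [hτ, hρ]

theorem shufflePerm_bijective : Function.Bijective (shufflePerm (a := a) (b := b)) := by
  rw [Fintype.bijective_iff_injective_and_card]
  refine ⟨shufflePerm_injective, ?_⟩
  rw [Fintype.card_prod, Fintype.card_prod, Fintype.card_finset_len, Fintype.card_perm,
    Fintype.card_perm, Fintype.card_perm, Fintype.card_fin, Fintype.card_fin, Fintype.card_fin,
    ← mul_assoc]
  simpa using Nat.choose_mul_factorial_mul_factorial (Nat.le_add_right a b)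

theorem permVal_shufflePerm_left_lt {i j : ℕ} (hi : i < a) (hj : j < a) :
    permVal (shufflePerm x) i < permVal (shufflePerm x) j ↔
      permVal x.2.1 i < permVal x.2.1 j := by
  rw [permVal_of_lt _ hi, permVal_of_lt _ hj, permVal_of_lt _ (by omega : i < a + b),
    permVal_of_lt _ (by omega : j < a + b)]
  have h1 := shufflePerm_castAdd x ⟨i, hi⟩
  have h2 := shufflePerm_castAdd x ⟨j, hj⟩
  simp only [Fin.castAdd_mk] at h1 h2
  rw [h1, h2, Fin.val_fin_lt, OrderEmbedding.lt_iff_lt, Fin.val_fin_lt]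

theorem permVal_shufflePerm_right_lt {i j : ℕ} (hi : i < b) (hj : j < b) :
    permVal (shufflePerm x) (a + i) < permVal (shufflePerm x) (a + j) ↔
      permVal x.2.2 i < permVal x.2.2 j := by
  rw [permVal_of_lt _ hi, permVal_of_lt _ hj, permVal_of_lt _ (by omega : a + i < a + b),
    permVal_of_lt _ (by omega : a + j < a + b)]
  have h1 := shufflePerm_natAdd x ⟨i, hi⟩
  have h2 := shufflePerm_natAdd x ⟨j, hj⟩
  simp only [Fin.natAdd_mk] at h1 h2
  rw [h1, h2, Fin.val_fin_lt, OrderEmbedding.lt_iff_lt, Fin.val_fin_lt]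

end shufflePerm

theorem card_filter_eq_of_shufflePerm {a b : ℕ} {P : Equiv.Perm (Fin (a + b)) → Prop}
    {A : Finset (Fin (a + b)) → Prop} {B : Equiv.Perm (Fin a) → Prop}
    {C : Equiv.Perm (Fin b) → Prop}
    [DecidablePred P] [DecidablePred A] [DecidablePred B] [DecidablePred C]
    (h : ∀ x, P (shufflePerm x) ↔ A x.1.1 ∧ B x.2.1 ∧ C x.2.2) :
    (Finset.univ.filter P).card =
      ((Finset.univ.powersetCard a).filter A).card * ((Finset.univ.filter B).card *
        (Finset.univ.filter C).card) := by
  have h1 : (Finset.univ.filter P).card = (Finset.univ.filter fun x => P (shufflePerm x)).card := by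
    symm
    refine Finset.card_bij (fun x _ => shufflePerm x) (by simp)
      (fun _ _ _ _ h => shufflePerm_injective h) fun σ hσ => ?_
    obtain ⟨x, rfl⟩ := shufflePerm_bijective.2 σ
    exact ⟨x, by simpa using hσ, rfl⟩
  have h2 : ((Finset.univ.powersetCard a).filter A).card = (Finset.univ.filter
      fun S : {S : Finset (Fin (a + b)) // S.card = a} => A S.1).card := by
    symm
    refine Finset.card_bij (fun S _ => S.1) (fun S hS => ?_) (fun _ _ _ _ h => Subtype.ext h)
      fun S hS => ?_
    · simpa [Finset.mem_powersetCard, S.2] using hS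
    · simp only [Finset.mem_filter, Finset.mem_powersetCard_univ] at hS
      exact ⟨⟨S, hS.1⟩, by simpa using hS.2, rfl⟩
  rw [h1, h2, ← Finset.card_product, ← Finset.card_product]
  congr 1
  ext x
  simp [h]

open Classical in
/-- The number of permutations of `Fin m` whose first `n` blocks have relative order `1 3 2`, with
descents between the blocks `0, …, k - 1` and ascents between the blocks `l, …, n - 1`. -/
noncomputable def blockCount (m k l n : ℕ) : ℕ :=
  (Finset.univ.filter fun σ : Equiv.Perm (Fin m) => IsBlocked n (permVal σ) ∧
    BlockDesc 0 k (permVal σ) ∧ BlockAsc l n (permVal σ)).card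

theorem card_SF_filter_ris (n : ℕ) :
    ((SF n).filter fun σ => ris σ = n).card = blockCount (3 * n) n n n := by
  classical
  rw [blockCount]
  congr 1
  refine Finset.ext fun σ => ?_
  rw [Finset.mem_filter, mem_SF_and_ris_eq_iff, Finset.mem_filter]
  have : BlockAsc n n (permVal σ) := fun i h1 h2 => by omega
  simp [this]

theorem blockCount_split (k l : ℕ) :
    blockCount (3 * (k + l)) k k (k + l) =
      (3 * (k + l)).choose (3 * k) * (blockCount (3 * k) k k k * blockCount (3 * l) 0 0 l) := by
  classical
  rw [mul_add]
  unfold blockCount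
  refine (card_filter_eq_of_shufflePerm (A := fun _ => True)
    (B := fun σ => IsBlocked k (permVal σ) ∧ BlockDesc 0 k (permVal σ) ∧ BlockAsc k k (permVal σ))
    (C := fun σ => IsBlocked l (permVal σ) ∧ BlockDesc 0 0 (permVal σ) ∧ BlockAsc 0 l (permVal σ))
    fun x => ?_).trans (by simp)
  have hL := fun i j hi hj => permVal_shufflePerm_left_lt (i := i) (j := j) x hi hj
  have hR := fun i j hi hj => permVal_shufflePerm_right_lt (i := i) (j := j) x hi hj
  constructor
  · rintro ⟨h1, h2, h3⟩
    refine ⟨trivial, ⟨fun i hi => ?_, fun i _ hi => ?_, fun i _ _ => by omega⟩,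
      ⟨fun i hi => ?_, fun i _ _ => by omega, fun i _ hi => ?_⟩⟩
    · rw [← hL _ _ (by omega) (by omega), ← hL _ _ (by omega) (by omega)]
      exact h1 i (by omega)
    · rw [← hL _ _ (by omega) (by omega)]
      exact h2 i (by omega) hi
    · rw [← hR _ _ (by omega) (by omega), ← hR _ _ (by omega) (by omega)]
      simpa only [mul_add, add_assoc] using h1 (k + i) (by omega)
    · rw [← hR _ _ (by omega) (by omega)]
      simpa only [mul_add, add_assoc] using h3 (k + i) (by omega) (by omega)
  · rintro ⟨-, ⟨h1, h2, -⟩, h3, -, h4⟩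
    refine ⟨fun i hi => ?_, fun i _ hi => ?_, fun i hi hi' => ?_⟩
    · by_cases hik : i < k
      · rw [hL _ _ (by omega) (by omega), hL _ _ (by omega) (by omega)]
        exact h1 i hik
      · obtain ⟨j, rfl⟩ := Nat.exists_eq_add_of_le (not_lt.1 hik)
        have := h3 j (by omega)
        rw [← hR _ _ (by omega) (by omega), ← hR _ _ (by omega) (by omega)] at this
        simpa only [mul_add, add_assoc] using this
    · rw [hL _ _ (by omega) (by omega)]
      exact h2 i (by omega) hi
    · obtain ⟨j, rfl⟩ := Nat.exists_eq_add_of_le hi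
      have := h4 j (by omega) (by omega)
      rw [← hR _ _ (by omega) (by omega)] at this
      simpa only [mul_add, add_assoc] using this

theorem blockCount_succ {k n : ℕ} (hk : k + 1 < n) :
    blockCount (3 * n) (k + 1) (k + 1) n =
      blockCount (3 * n) (k + 2) (k + 1) n + blockCount (3 * n) (k + 1) k n := by
  classical
  unfold blockCount
  rw [← Finset.card_union_of_disjoint]
  · congr 1
    ext σ
    simp only [Finset.mem_filter, Finset.mem_union, Finset.mem_univ, true_and]
    constructor
    · rintro ⟨h1, h2, h3⟩
      rcases lt_trichotomy (permVal σ (3 * k + 3)) (permVal σ (3 * k + 2)) with h | h | h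
      · refine Or.inl ⟨h1, fun i _ hi => ?_, h3⟩
        rcases eq_or_ne i k with rfl | hik
        · exact h
        · exact h2 i (by omega) (by omega)
      · rw [permVal_inj σ (by omega) (by omega)] at h
        omega
      · refine Or.inr ⟨h1, h2, fun i hi hi' => ?_⟩
        rcases eq_or_ne i k with rfl | hik
        · exact h
        · exact h3 i (by omega) hi'
    · rintro (⟨h1, h2, h3⟩ | ⟨h1, h2, h3⟩)
      · exact ⟨h1, fun i hi hi' => h2 i hi (by omega), h3⟩
      · exact ⟨h1, h2, fun i hi hi' => h3 i (by omega) hi'⟩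
  · rw [Finset.disjoint_filter]
    rintro σ - ⟨-, h, -⟩ ⟨-, -, h'⟩
    exact absurd (h k (by omega) (by omega)) (h' k le_rfl hk).not_gt

theorem blockCount_zero (m n : ℕ) : blockCount m 0 0 n = blockCount m 1 0 n := by
  unfold blockCount BlockDesc
  congr! 5 with σ
  exact ⟨fun _ _ _ => by omega, fun _ _ _ => by omega⟩

theorem blockCount_self (m n : ℕ) :
    blockCount m (n + 1) (n + 1) (n + 1) = blockCount m (n + 1) n (n + 1) := by
  unfold blockCount BlockAsc
  congr! 5 with σ
  exact ⟨fun _ _ _ => by omega, fun _ _ _ => by omega⟩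

theorem sum_range_neg_one_pow_blockCount {n j : ℕ} (hj : j < n) :
    ∑ k ∈ Finset.range (j + 1), (-1 : ℚ) ^ k * blockCount (3 * n) k k n =
      (-1) ^ j * blockCount (3 * n) (j + 1) j n := by
  induction j with
  | zero => simp [blockCount_zero]
  | succ j ih =>
    rw [Finset.sum_range_succ, ih (by omega), blockCount_succ hj]
    push_cast
    ring

theorem sum_blockCount_eq_zero (n : ℕ) :
    ∑ k ∈ Finset.range (n + 2), (-1 : ℚ) ^ k * blockCount (3 * (n + 1)) k k (n + 1) = 0 := by
  rw [Finset.sum_range_succ, sum_range_neg_one_pow_blockCount (Nat.lt_succ_self n),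
    blockCount_self]
  ring

theorem blockCount_empty : blockCount 0 0 0 0 = 1 := by
  simp [blockCount, IsBlocked, BlockDesc, BlockAsc]

theorem lt_of_isBlocked_of_blockAsc {n : ℕ} {v : ℕ → ℕ} (h1 : IsBlocked n v) (h2 : BlockAsc 0 n v)
    {j : ℕ} (hj : 3 ≤ j) (hjn : j < 3 * n) : v 2 < v j := by
  have key : ∀ i, i + 1 < n → v 2 < v (3 * i + 3) := by
    intro i
    induction i with
    | zero => exact h2 0 le_rfl
    | succ i ih =>
      intro hi
      exact (ih (by omega)).trans ((h1 (i + 1) (by omega)).1.trans (h2 (i + 1) (by omega) hi))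
  obtain ⟨i, hi⟩ : ∃ i, j / 3 = i + 1 := ⟨j / 3 - 1, by omega⟩
  have h3 := key i (by omega)
  have h4 := h1 (i + 1) (by omega)
  obtain h | h | h : j = 3 * i + 3 ∨ j = 3 * (i + 1) + 1 ∨ j = 3 * (i + 1) + 2 := by omega
  · rwa [h]
  · rw [h]
    exact h3.trans (h4.1.trans h4.2)
  · rw [h]
    exact h3.trans h4.1

theorem card_isBlocked_one [DecidablePred fun τ : Equiv.Perm (Fin 3) => IsBlocked 1 (permVal τ)] :
    (Finset.univ.filter fun τ : Equiv.Perm (Fin 3) => IsBlocked 1 (permVal τ)).card = 1 := by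
  have h : (Finset.univ.filter fun τ : Equiv.Perm (Fin 3) => τ 0 < τ 2 ∧ τ 2 < τ 1).card = 1 := by
    decide
  refine Eq.trans (congrArg _ ?_) h
  ext τ
  simp [IsBlocked, permVal]

theorem card_powersetCard_three_filter (n : ℕ) :
    ((Finset.univ.powersetCard 3).filter
      fun S : Finset (Fin (3 + n)) => ∀ y : Fin (3 + n), (y : ℕ) < 2 → y ∈ S).card = n + 1 := by
  conv_rhs => rw [← Finset.card_fin (n + 1)]
  symm
  refine Finset.card_bij
    (fun y _ => {⟨0, by omega⟩, ⟨1, by omega⟩, ⟨(y : ℕ) + 2, by omega⟩}) ?_ ?_ ?_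
  · intro y _
    simp only [Finset.mem_filter, Finset.mem_powersetCard_univ]
    refine ⟨Finset.card_eq_three.2 ⟨_, _, _, ?_, ?_, ?_, rfl⟩, fun z hz => ?_⟩
    · simp
    · simp
    · simp
    · simp only [Finset.mem_insert, Finset.mem_singleton, Fin.ext_iff]
      omega
  · intro y _ z _ h
    have : (⟨(y : ℕ) + 2, by omega⟩ : Fin (3 + n)) ∈
        ({⟨0, by omega⟩, ⟨1, by omega⟩, ⟨(z : ℕ) + 2, by omega⟩} : Finset (Fin (3 + n))) := by
      rw [← h]
      simp
    simp only [Finset.mem_insert, Finset.mem_singleton, Fin.ext_iff] at this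
    exact Fin.ext (by omega)
  · intro S hS
    simp only [Finset.mem_filter, Finset.mem_powersetCard_univ] at hS
    obtain ⟨hc, hS⟩ := hS
    have h0 := hS ⟨0, by omega⟩ (by simp)
    have h1 := hS ⟨1, by omega⟩ (by simp)
    have hcard : ((S.erase ⟨0, by omega⟩).erase ⟨1, by omega⟩).card = 1 := by
      rw [Finset.card_erase_of_mem (by simp [h1]), Finset.card_erase_of_mem h0, hc]
    obtain ⟨z, hz⟩ := Finset.card_eq_one.1 hcard
    have hz' : z ∈ (S.erase ⟨0, by omega⟩).erase ⟨1, by omega⟩ := by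
      rw [hz]
      exact Finset.mem_singleton_self z
    simp only [Finset.mem_erase, ne_eq, Fin.ext_iff] at hz'
    refine ⟨⟨(z : ℕ) - 2, by omega⟩, Finset.mem_univ _, ?_⟩
    have hzz : (⟨(z : ℕ) - 2 + 2, by omega⟩ : Fin (3 + n)) = z := Fin.ext (by simp only; omega)
    simp only [hzz]
    rw [← Finset.insert_erase h0, ← Finset.insert_erase (a := (⟨1, by omega⟩ : Fin (3 + n)))
      (s := S.erase ⟨0, by omega⟩) (by simp [h1]), hz]

theorem blockCount_chain_succ (n : ℕ) :
    blockCount (3 * (n + 1)) 0 0 (n + 1) = (3 * n + 1) * blockCount (3 * n) 0 0 n := by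
  classical
  rw [show 3 * (n + 1) = 3 + 3 * n by ring]
  unfold blockCount
  refine (card_filter_eq_of_shufflePerm
    (A := fun S => ∀ y : Fin (3 + 3 * n), (y : ℕ) < 2 → y ∈ S)
    (B := fun τ => IsBlocked 1 (permVal τ))
    (C := fun σ => IsBlocked n (permVal σ) ∧ BlockDesc 0 0 (permVal σ) ∧ BlockAsc 0 n (permVal σ))
    fun x => ?_).trans (by rw [card_powersetCard_three_filter, card_isBlocked_one, one_mul])
  have hL := fun i j hi hj => permVal_shufflePerm_left_lt (i := i) (j := j) x hi hj
  have hR := fun i j hi hj => permVal_shufflePerm_right_lt (i := i) (j := j) x hi hj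
  have hmem : ∀ i (hi : i < 3 + 3 * n) (y : Fin (3 + 3 * n)), permVal (shufflePerm x) i = y →
      (y ∈ x.1.1 ↔ i < 3) := by
    intro i hi y hy
    rw [permVal_of_lt _ hi, Fin.val_inj] at hy
    rw [← hy, shufflePerm_mem_iff]
  constructor
  · rintro ⟨h1, -, h2⟩
    refine ⟨fun y hy => ?_, fun i hi => ?_, fun i hi => ?_, fun i _ _ => by omega,
      fun i _ hi => ?_⟩
    · obtain ⟨j, hj, hjy⟩ := exists_permVal_eq (shufflePerm x) y.2
      rw [hmem j hj y hjy]
      by_contra hj3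
      have h3 := lt_of_isBlocked_of_blockAsc h1 h2 (j := j) (by omega) (by omega)
      have h4 := h1 0 (by omega)
      simp only [mul_zero, zero_add] at h4
      omega
    · rw [← hL _ _ (by omega) (by omega), ← hL _ _ (by omega) (by omega)]
      exact h1 i (by omega)
    · rw [← hR _ _ (by omega) (by omega), ← hR _ _ (by omega) (by omega)]
      have := h1 (1 + i) (by omega)
      simpa only [mul_add, add_assoc, mul_one] using this
    · rw [← hR _ _ (by omega) (by omega)]
      have := h2 (1 + i) (by omega) (by omega)
      simpa only [mul_add, add_assoc, mul_one] using this
  · rintro ⟨hS, h1, h2, -, h3⟩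
    have hfirst := h1 0 one_pos
    rw [← hL _ _ (by omega) (by omega), ← hL _ _ (by omega) (by omega)] at hfirst
    refine ⟨fun i hi => ?_, fun i _ hi => by omega, fun i hi hi' => ?_⟩
    · rcases i with - | i
      · exact hfirst
      · have := h2 i (by omega)
        rw [← hR _ _ (by omega) (by omega), ← hR _ _ (by omega) (by omega)] at this
        rw [add_comm i 1]
        simpa only [mul_add, add_assoc, mul_one] using this
    · rcases i with - | i
      · obtain ⟨j0, hj0, hv0⟩ := exists_permVal_eq (shufflePerm x) (x := 0) (by omega)
        obtain ⟨j1, hj1, hv1⟩ := exists_permVal_eq (shufflePerm x) (x := 1) (by omega)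
        have hj0' := (hmem j0 hj0 ⟨0, by omega⟩ hv0).1 (hS _ (by simp))
        have hj1' := (hmem j1 hj1 ⟨1, by omega⟩ hv1).1 (hS _ (by simp))
        have hv3 : 2 ≤ permVal (shufflePerm x) 3 := by
          by_contra hlt
          have := (hmem 3 (by omega) ⟨_, permVal_lt _ (by omega)⟩ rfl).1 (hS _ (not_le.1 hlt))
          omega
        simp only [mul_zero, zero_add] at hfirst ⊢
        interval_cases j0 <;> interval_cases j1 <;> omega
      · have := h3 i (by omega) (by omega)
        rw [← hR _ _ (by omega) (by omega)] at this
        rw [add_comm i 1]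
        simpa only [mul_add, add_assoc, mul_one] using this

theorem blockCount_chain (n : ℕ) :
    (blockCount (3 * n) 0 0 n : ℚ) = ∏ k ∈ Finset.Icc 1 n, (3 * (k : ℚ) - 2) := by
  induction n with
  | zero => simp [blockCount_empty]
  | succ n ih =>
    rw [blockCount_chain_succ, Finset.prod_Icc_succ_top (by omega), ← ih]
    push_cast
    ring

theorem coeff_Mser (m : ℕ) : PowerSeries.coeff m Mser =
    if 3 ∣ m then (blockCount m (m / 3) (m / 3) (m / 3) : ℚ) / m.factorial else 0 := by
  rw [Mser, PowerSeries.coeff_mk]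
  rcases eq_or_ne m 0 with rfl | hm
  · simp [blockCount_empty]
  · simp only [hm, if_false, Nat.dvd_iff_mod_eq_zero]
    split_ifs with h
    · rw [card_SF_filter_ris, Nat.mul_div_cancel' (Nat.dvd_of_mod_eq_zero h)]
    · rfl

theorem coeff_Nser (m : ℕ) : PowerSeries.coeff m Nser =
    if 3 ∣ m then (-1) ^ (m / 3) * (blockCount m 0 0 (m / 3) : ℚ) / m.factorial else 0 := by
  rw [Nser, PowerSeries.coeff_mk]
  rcases eq_or_ne m 0 with rfl | hm
  · simp [blockCount_empty]
  · simp only [hm, if_false, Nat.dvd_iff_mod_eq_zero]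
    split_ifs with h
    · rw [← blockCount_chain, Nat.mul_div_cancel' (Nat.dvd_of_mod_eq_zero h)]
    · rfl

theorem coeff_Mser_mul_Nser_of_not_dvd {m : ℕ} (hm : ¬ 3 ∣ m) :
    PowerSeries.coeff m (Mser * Nser) = 0 := by
  rw [PowerSeries.coeff_mul]
  refine Finset.sum_eq_zero fun p hp => ?_
  rw [Finset.HasAntidiagonal.mem_antidiagonal] at hp
  rw [coeff_Mser, coeff_Nser]
  split_ifs with h1 h2
  · exact absurd (hp ▸ dvd_add h1 h2) hm
  all_goals simp

theorem coeff_Mser_mul_Nser_three_mul (n : ℕ) :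
    PowerSeries.coeff (3 * n) (Mser * Nser) = (-1) ^ n / (3 * n).factorial *
      ∑ k ∈ Finset.range (n + 1), (-1 : ℚ) ^ k * blockCount (3 * n) k k n := by
  rw [PowerSeries.coeff_mul, Finset.Nat.sum_antidiagonal_eq_sum_range_succ
    (fun i j => PowerSeries.coeff i Mser * PowerSeries.coeff j Nser), Finset.mul_sum]
  symm
  refine Finset.sum_of_injOn (3 * ·) (fun a _ b _ h => by simpa using h) ?_ ?_ ?_
  · intro k hk
    simp only [Finset.coe_range, Set.mem_Iio] at hk ⊢
    omega
  · intro i _ hi'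
    rw [coeff_Mser, if_neg, zero_mul]
    rintro ⟨k, rfl⟩
    refine hi' ⟨k, ?_, rfl⟩
    simp_all
  · intro k hk
    obtain ⟨l, rfl⟩ := Nat.exists_eq_add_of_le (Nat.lt_succ_iff.1 (Finset.mem_range.1 hk))
    rw [show 3 * (k + l) - 3 * k = 3 * l by omega, coeff_Mser, coeff_Nser,
      if_pos (dvd_mul_right _ _), if_pos (dvd_mul_right _ _),
      Nat.mul_div_cancel_left _ (by norm_num), Nat.mul_div_cancel_left _ (by norm_num),
      blockCount_split]
    have hfac := Nat.choose_mul_factorial_mul_factorial (show 3 * k ≤ 3 * (k + l) by omega)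
    rw [show 3 * (k + l) - 3 * k = 3 * l by omega] at hfac
    have h1 : ((3 * k).factorial : ℚ) ≠ 0 := by positivity
    have h2 : ((3 * l).factorial : ℚ) ≠ 0 := by positivity
    have h3 : ((3 * (k + l)).choose (3 * k) : ℚ) ≠ 0 := by
      exact_mod_cast (Nat.choose_pos (by omega)).ne'
    have h4 : ((-1 : ℚ) ^ k) * (-1) ^ k = 1 := by rw [← mul_pow]; simp
    rw [← hfac]
    push_cast
    field_simp
    rw [pow_add]
    linear_combination ((-1 : ℚ) ^ l * blockCount (3 * k) k k k * blockCount (3 * l) 0 0 l) * h4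

theorem Mser_mul_Nser : Mser * Nser = 1 := by
  ext m
  rw [PowerSeries.coeff_one]
  by_cases hm : 3 ∣ m
  · obtain ⟨n, rfl⟩ := hm
    rw [coeff_Mser_mul_Nser_three_mul]
    rcases n with - | n
    · simp [blockCount_empty]
    · rw [sum_blockCount_eq_zero, mul_zero, if_neg (by omega)]
  · rw [coeff_Mser_mul_Nser_of_not_dvd hm, if_neg (fun h => hm (by simp [h]))]

theorem minimal_rises :
    (∀ n : ℕ, 1 ≤ n → ∀ σ ∈ SF n, n ≤ ris σ) ∧ Mser * Nser = 1 :=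
  ⟨fun _ _ _ hσ => le_ris_of_mem_SF hσ, Mser_mul_Nser⟩
end
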